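/- arXiv:math/0311442 — 2 statements merged into one kernel-verified Lean document; each statement's English description precedes it below -/
import Mathlib

section
/- Let n ≥ 1 and let Λ = (λ_{i,j}), Λ' = (λ'_{k,t}) ∈ M_n(k*) be multiplicatively antisymmetric. Then the quantum tori O_Λ((k*)^n) and O_{Λ'}((k*)^n) are isomorphic as k-algebras if and only if there exists a matrix H = (h_{k,i}) ∈ GL_n(ℤ) such that λ_{i,j} = ∏_{1≤k,t≤n} (λ'_{k,t})^{h_{k,i}·h_{t,j}} for all 1 ≤ i,j ≤ n. -/
universe u

/-- A matrix is multiplicatively antisymmetric if `Λ i i = 1` and `Λ i j * Λ j i = 1`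
for all `i, j`. -/
def Matrix.MulAntisymmetric {k : Type u} [Field k] {n : ℕ}
    (Λ : Matrix (Fin n) (Fin n) k) : Prop :=
  (∀ i, Λ i i = 1) ∧ ∀ i j, Λ i j * Λ j i = 1

inductive QTorusRel (k : Type u) [Field k] {n : ℕ} (Λ : Matrix (Fin n) (Fin n) k) :
    FreeAlgebra k (Fin n ⊕ Fin n) → FreeAlgebra k (Fin n ⊕ Fin n) → Prop
  | comm (i j : Fin n) :
      QTorusRel k Λ (FreeAlgebra.ι k (Sum.inl i) * FreeAlgebra.ι k (Sum.inl j))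
        (algebraMap k _ (Λ i j) * (FreeAlgebra.ι k (Sum.inl j) * FreeAlgebra.ι k (Sum.inl i)))
  | mul_inv (i : Fin n) :
      QTorusRel k Λ (FreeAlgebra.ι k (Sum.inl i) * FreeAlgebra.ι k (Sum.inr i)) 1
  | inv_mul (i : Fin n) :
      QTorusRel k Λ (FreeAlgebra.ι k (Sum.inr i) * FreeAlgebra.ι k (Sum.inl i)) 1

/-- The quantum torus `O_Λ((k*)^n)`. -/
def QuantumTorus (k : Type u) [Field k] {n : ℕ} (Λ : Matrix (Fin n) (Fin n) k) :=
  RingQuot (QTorusRel k Λ)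

noncomputable instance (k : Type u) [Field k] {n : ℕ} (Λ : Matrix (Fin n) (Fin n) k) :
    Ring (QuantumTorus k Λ) := by unfold QuantumTorus; infer_instance

noncomputable instance (k : Type u) [Field k] {n : ℕ} (Λ : Matrix (Fin n) (Fin n) k) :
    Algebra k (QuantumTorus k Λ) := by unfold QuantumTorus; infer_instance

/-- The generator `y_i` of the quantum torus. -/
noncomputable def QuantumTorus.y (k : Type u) [Field k] {n : ℕ}
    (Λ : Matrix (Fin n) (Fin n) k) (i : Fin n) : QuantumTorus k Λ :=
  RingQuot.mkAlgHom k (QTorusRel k Λ) (FreeAlgebra.ι k (Sum.inl i))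

/-- The generator `y_i⁻¹` of the quantum torus. -/
noncomputable def QuantumTorus.yinv (k : Type u) [Field k] {n : ℕ}
    (Λ : Matrix (Fin n) (Fin n) k) (i : Fin n) : QuantumTorus k Λ :=
  RingQuot.mkAlgHom k (QTorusRel k Λ) (FreeAlgebra.ι k (Sum.inr i))


namespace QuantumTorus

open Module

section Presentation

variable {k : Type u} [Field k] {n : ℕ} (Λ : Matrix (Fin n) (Fin n) k)

/-- The projection from the free algebra onto the quantum torus. -/
noncomputable def mk : FreeAlgebra k (Fin n ⊕ Fin n) →ₐ[k] QuantumTorus k Λ :=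
  RingQuot.mkAlgHom k (QTorusRel k Λ)

theorem mk_surjective : Function.Surjective (mk Λ) :=
  RingQuot.mkAlgHom_surjective k (QTorusRel k Λ)

theorem mk_inl (i : Fin n) : mk Λ (FreeAlgebra.ι k (Sum.inl i)) = y k Λ i := rfl

theorem mk_inr (i : Fin n) : mk Λ (FreeAlgebra.ι k (Sum.inr i)) = yinv k Λ i := rfl

theorem mk_rel {a b : FreeAlgebra k (Fin n ⊕ Fin n)} (h : QTorusRel k Λ a b) :
    mk Λ a = mk Λ b :=
  RingQuot.mkAlgHom_rel k h

theorem y_mul_y (i j : Fin n) : y k Λ i * y k Λ j = Λ i j • (y k Λ j * y k Λ i) := by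
  simpa [mk_inl, Algebra.smul_def] using mk_rel Λ (.comm i j)

theorem y_mul_yinv (i : Fin n) : y k Λ i * yinv k Λ i = 1 := by
  simpa [mk_inl, mk_inr] using mk_rel Λ (.mul_inv i)

theorem yinv_mul_y (i : Fin n) : yinv k Λ i * y k Λ i = 1 := by
  simpa [mk_inl, mk_inr] using mk_rel Λ (.inv_mul i)

/-- The generator `y_i` as a unit. -/
noncomputable def yUnit (i : Fin n) : (QuantumTorus k Λ)ˣ :=
  ⟨y k Λ i, yinv k Λ i, y_mul_yinv Λ i, yinv_mul_y Λ i⟩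

variable {Λ}

/-- A family of units satisfying the defining relations induces an algebra homomorphism. -/
theorem exists_lift {R : Type*} [Ring R] [Algebra k R] (w : Fin n → Rˣ)
    (hw : ∀ i j, (w i * w j : R) = Λ i j • (w j * w i : R)) :
    ∃ f : QuantumTorus k Λ →ₐ[k] R, ∀ i, f (y k Λ i) = w i := by
  let g : FreeAlgebra k (Fin n ⊕ Fin n) →ₐ[k] R :=
    FreeAlgebra.lift k (Sum.elim (fun i => (w i : R)) (fun i => ((w i)⁻¹ : Rˣ)))
  have hg : ∀ ⦃a b⦄, QTorusRel k Λ a b → g a = g b := by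
    rintro _ _ (⟨i, j⟩ | i | i)
    · simpa [g, Algebra.smul_def] using hw i j
    · simp [g]
    · simp [g]
  refine ⟨RingQuot.liftAlgHom k ⟨g, hg⟩, fun i => ?_⟩
  exact (RingQuot.liftAlgHom_mkAlgHom_apply k g hg _).trans (by simp [g])

end Presentation

section Projective

variable {k G R : Type*} [Field k] [AddCommGroup G] [Ring R] [Algebra k R]

variable (k) in
/-- A family indexed by an additive group that is multiplicative up to nonzero scalars. -/
structure IsProjective (p : G → R) : Prop where
  map_zero : ∃ c : kˣ, p 0 = c • (1 : R)
  map_add : ∀ a b, ∃ c : kˣ, p a * p b = c • p (a + b)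

namespace IsProjective

variable {p q : G → R}

theorem mul_neg (hp : IsProjective k p) (a : G) : ∃ c : kˣ, p a * p (-a) = c • (1 : R) := by
  obtain ⟨c, hc⟩ := hp.map_add a (-a)
  obtain ⟨d, hd⟩ := hp.map_zero
  exact ⟨c * d, by rw [hc, add_neg_cancel, hd, mul_smul]⟩

theorem neg_mul (hp : IsProjective k p) (a : G) : ∃ c : kˣ, p (-a) * p a = c • (1 : R) := by
  simpa using hp.mul_neg (-a)

theorem isUnit (hp : IsProjective k p) (a : G) : IsUnit (p a) := by
  obtain ⟨c, hc⟩ := hp.mul_neg a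
  obtain ⟨d, hd⟩ := hp.neg_mul a
  refine isUnit_iff_exists_and_exists.2 ⟨⟨c⁻¹ • p (-a), ?_⟩, ⟨d⁻¹ • p (-a), ?_⟩⟩
  · rw [mul_smul_comm, hc, inv_smul_smul]
  · rw [smul_mul_assoc, hd, inv_smul_smul]

theorem comp {S G' : Type*} [Ring S] [Algebra k S] [AddCommGroup G'] (hp : IsProjective k p)
    (f : R →ₐ[k] S) (h : G' →+ G) : IsProjective k (fun a => f (p (h a))) where
  map_zero := by
    obtain ⟨c, hc⟩ := hp.map_zero
    exact ⟨c, by simp [hc, Units.smul_def]⟩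
  map_add a b := by
    obtain ⟨c, hc⟩ := hp.map_add (h a) (h b)
    exact ⟨c, by simp [← _root_.map_mul, hc, Units.smul_def]⟩

/-- Two projective families agree up to scalars on a subgroup. -/
def eqLocus (hp : IsProjective k p) (hq : IsProjective k q) : AddSubgroup G where
  carrier := {a | ∃ c : kˣ, p a = c • q a}
  zero_mem' := by
    obtain ⟨c, hc⟩ := hp.map_zero
    obtain ⟨d, hd⟩ := hq.map_zero
    exact ⟨c * d⁻¹, by rw [hc, hd, mul_smul, inv_smul_smul]⟩
  add_mem' := by
    rintro a b ⟨c, hc⟩ ⟨d, hd⟩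
    obtain ⟨s, hs⟩ := hp.map_add a b
    obtain ⟨t, ht⟩ := hq.map_add a b
    refine ⟨s⁻¹ * (c * d * t), ?_⟩
    rw [mul_smul, eq_inv_smul_iff, ← hs, hc, hd, smul_mul_smul_comm, ht, ← mul_smul (c * d)]
  neg_mem' := by
    rintro a ⟨c, hc⟩
    obtain ⟨s, hs⟩ := hp.neg_mul a
    obtain ⟨t, ht⟩ := hq.mul_neg a
    refine ⟨t⁻¹ * (c⁻¹ * s), ?_⟩
    have h : p (-a) * q a = (c⁻¹ * s) • (1 : R) := by
      rw [mul_smul, eq_inv_smul_iff, ← mul_smul_comm, ← hc, hs]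
    rw [mul_smul, eq_inv_smul_iff]
    calc t • p (-a) = p (-a) * (q a * q (-a)) := by rw [ht, mul_smul_comm, mul_one]
      _ = (c⁻¹ * s) • q (-a) := by rw [← mul_assoc, h, smul_mul_assoc, one_mul]

theorem exists_smul_eq {n : ℕ} {p q : (Fin n → ℤ) → R} (hp : IsProjective k p)
    (hq : IsProjective k q)
    (h : ∀ i, ∃ c : kˣ, p (Pi.single i 1) = c • q (Pi.single i 1)) (a : Fin n → ℤ) :
    ∃ c : kˣ, p a = c • q a := by
  suffices a ∈ hp.eqLocus hq from this
  rw [← Finset.univ_sum_single a]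
  refine sum_mem fun i _ => ?_
  have : Pi.single i (a i) = a i • (Pi.single i 1 : Fin n → ℤ) := by
    rw [← Pi.single_smul, smul_eq_mul, mul_one]
  rw [this]
  exact zsmul_mem (h i) _

end IsProjective

end Projective

section Monomials

variable {k : Type u} [Field k] {n : ℕ}

/-- The units of the quantum torus coming from nonzero scalars. -/
noncomputable abbrev scalarUnits (Λ : Matrix (Fin n) (Fin n) k) : Subgroup (QuantumTorus k Λ)ˣ :=
  (Units.map (algebraMap k (QuantumTorus k Λ)).toMonoidHom).range

instance (Λ : Matrix (Fin n) (Fin n) k) : (scalarUnits Λ).Normal := by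
  refine ⟨?_⟩
  rintro _ ⟨c, rfl⟩ g
  refine ⟨c, ?_⟩
  rw [eq_mul_inv_iff_mul_eq]
  ext
  exact Algebra.commutes _ _

theorem mk_eq_mk_iff (Λ : Matrix (Fin n) (Fin n) k) (u v : (QuantumTorus k Λ)ˣ) :
    (u : (QuantumTorus k Λ)ˣ ⧸ scalarUnits Λ) = v ↔
      ∃ c : kˣ, (v : QuantumTorus k Λ) = c • (u : QuantumTorus k Λ) := by
  rw [QuotientGroup.eq]
  refine exists_congr fun c => ?_
  rw [eq_inv_mul_iff_mul_eq, Units.ext_iff, eq_comm, Units.smul_def, Algebra.smul_def,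
    Algebra.commutes]
  rfl

/-- Choosing representatives modulo scalars of the products of powers of the generators gives a
projective family of monomials. -/
theorem exists_monomials (L : Fin n → Fin n → kˣ) (Λ : Matrix (Fin n) (Fin n) k)
    (hL : ∀ i j, Λ i j = L i j) :
    ∃ p : (Fin n → ℤ) → QuantumTorus k Λ, IsProjective k p ∧
      ∀ i, ∃ c : kˣ, p (Pi.single i 1) = c • y k Λ i := by
  let ϕ : Fin n → Multiplicative ℤ →* (QuantumTorus k Λ)ˣ ⧸ scalarUnits Λ :=
    fun i => zpowersHom _ ((yUnit Λ i : (QuantumTorus k Λ)ˣ) : _ ⧸ scalarUnits Λ)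
  have hϕ : Pairwise fun i j => ∀ a b, Commute (ϕ i a) (ϕ j b) := by
    intro i j _ a b
    simp only [ϕ, zpowersHom_apply]
    refine Commute.zpow_zpow ?_ _ _
    refine ((mk_eq_mk_iff Λ (yUnit Λ j * yUnit Λ i) (yUnit Λ i * yUnit Λ j)).2 ⟨L i j, ?_⟩).symm
    rw [Units.smul_def, ← hL]
    exact y_mul_y Λ i j
  let π := MonoidHom.noncommPiCoprod ϕ hϕ
  let m : (Fin n → ℤ) → (QuantumTorus k Λ)ˣ :=
    fun a => (π (fun i => Multiplicative.ofAdd (a i))).out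
  have hm : ∀ a, (m a : (QuantumTorus k Λ)ˣ ⧸ scalarUnits Λ) =
      π (fun i => Multiplicative.ofAdd (a i)) := fun a => QuotientGroup.out_eq' _
  refine ⟨fun a => m a, ⟨?_, fun a b => ?_⟩, fun i => ?_⟩
  · refine (mk_eq_mk_iff Λ 1 (m 0)).1 ?_
    rw [hm]
    exact (map_one π).symm
  · refine (mk_eq_mk_iff Λ (m (a + b)) (m a * m b)).1 ?_
    rw [QuotientGroup.mk_mul, hm, hm, hm, ← map_mul]
    rfl
  · refine (mk_eq_mk_iff Λ (yUnit Λ i) (m (Pi.single i 1))).1 ?_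
    have : (fun j => Multiplicative.ofAdd ((Pi.single i 1 : Fin n → ℤ) j)) =
        Pi.mulSingle i (Multiplicative.ofAdd (1 : ℤ)) := by
      ext j
      obtain rfl | h := eq_or_ne j i <;> simp [*]
    rw [hm, this]
    simp only [π, MonoidHom.noncommPiCoprod_mulSingle]
    simp [ϕ]

/-- A projective family containing the generators spans the quantum torus. -/
theorem span_range_eq_top {Λ : Matrix (Fin n) (Fin n) k} {p : (Fin n → ℤ) → QuantumTorus k Λ}
    (hp : IsProjective k p) (hy : ∀ i, ∃ c : kˣ, p (Pi.single i 1) = c • y k Λ i) :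
    Submodule.span k (Set.range p) = ⊤ := by
  set S := Submodule.span k (Set.range p) with hS
  have hpS : ∀ a (c : kˣ), c • p a ∈ S := fun a c =>
    S.smul_mem (c : k) (Submodule.subset_span ⟨a, rfl⟩)
  have h1 : (1 : QuantumTorus k Λ) ∈ S := by
    obtain ⟨c, hc⟩ := hp.map_zero
    rw [← inv_smul_eq_iff] at hc
    exact hc ▸ hpS _ _
  have hmul : ∀ a b, a ∈ S → b ∈ S → a * b ∈ S := by
    intro a b ha hb
    have h := Submodule.mul_mem_mul ha hb
    rw [hS, Submodule.span_mul_span] at h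
    refine Submodule.span_le.2 ?_ h
    rintro _ ⟨_, ⟨a, rfl⟩, _, ⟨b, rfl⟩, rfl⟩
    obtain ⟨c, hc⟩ := hp.map_add a b
    simpa only [hc, SetLike.mem_coe] using hpS _ c
  rw [eq_top_iff]
  rintro x -
  obtain ⟨x, rfl⟩ := mk_surjective Λ x
  induction x with
  | grade0 r =>
    rw [AlgHom.commutes, Algebra.algebraMap_eq_smul_one]
    exact S.smul_mem _ h1
  | grade1 i =>
    obtain i | i := i
    · obtain ⟨c, hc⟩ := hy i
      rw [← inv_smul_eq_iff] at hc
      rw [mk_inl, ← hc]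
      exact hpS _ _
    · obtain ⟨c, hc⟩ := hy i
      obtain ⟨d, hd⟩ := hp.neg_mul (Pi.single i 1)
      have : yinv k Λ i = (d⁻¹ * c) • p (-Pi.single i 1) := by
        rw [mul_smul, eq_inv_smul_iff, ← one_mul (yinv k Λ i), ← smul_mul_assoc, ← hd, hc,
          mul_smul_comm, smul_mul_assoc, mul_assoc, y_mul_yinv, mul_one]
      rw [mk_inr, this]
      exact hpS _ _
  | mul a b ha hb => rw [map_mul]; exact hmul _ _ ha hb
  | add a b ha hb => rw [map_add]; exact S.add_mem ha hb

end Monomials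

section TwistedRegularRepresentation

variable {k : Type u} [Field k] {n : ℕ} (L : Fin n → Fin n → kˣ)

/-- The bicharacter `(a, b) ↦ ∏_{j < i} λ_{i,j}^{a_i b_j}`, which is the commutation cocycle of the
ordered monomials in the generators. -/
def bicharacter (a b : Fin n → ℤ) : kˣ :=
  ∏ i, ∏ j, if j < i then L i j ^ (a i * b j) else 1

theorem bicharacter_add_left (a b c : Fin n → ℤ) :
    bicharacter L (a + b) c = bicharacter L a c * bicharacter L b c := by
  simp only [bicharacter, ← Finset.prod_mul_distrib]
  refine Finset.prod_congr rfl fun i _ => Finset.prod_congr rfl fun j _ => ?_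
  split_ifs <;> simp [add_mul, zpow_add]

theorem bicharacter_add_right (a b c : Fin n → ℤ) :
    bicharacter L a (b + c) = bicharacter L a b * bicharacter L a c := by
  simp only [bicharacter, ← Finset.prod_mul_distrib]
  refine Finset.prod_congr rfl fun i _ => Finset.prod_congr rfl fun j _ => ?_
  split_ifs <;> simp [mul_add, zpow_add]

@[simp]
theorem bicharacter_zero_left (b : Fin n → ℤ) : bicharacter L 0 b = 1 := by
  simp [bicharacter]

@[simp]
theorem bicharacter_zero_right (a : Fin n → ℤ) : bicharacter L a 0 = 1 := by
  simp [bicharacter]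

theorem bicharacter_swap {L : Fin n → Fin n → kˣ} (h1 : ∀ i, L i i = 1)
    (h2 : ∀ i j, L i j * L j i = 1) (a b : Fin n → ℤ) :
    bicharacter L a b = (∏ i, ∏ j, L i j ^ (a i * b j)) * bicharacter L b a := by
  have hswap : bicharacter L b a = ∏ i, ∏ j, if i < j then L j i ^ (b j * a i) else 1 :=
    Finset.prod_comm
  rw [hswap, bicharacter]
  simp only [← Finset.prod_mul_distrib]
  refine Finset.prod_congr rfl fun i _ => Finset.prod_congr rfl fun j _ => ?_
  obtain h | rfl | h := lt_trichotomy i j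
  · rw [if_neg h.not_gt, if_pos h, mul_comm (b j), ← mul_zpow, h2, one_zpow]
  · simp [h1]
  · simp [h, h.not_gt]

theorem prod_single (i j : Fin n) :
    ∏ s, ∏ t, L s t ^ ((Pi.single i 1 : Fin n → ℤ) s * (Pi.single j 1 : Fin n → ℤ) t) = L i j := by
  rw [Fintype.prod_eq_single i fun s hs => by simp [hs],
    Fintype.prod_eq_single j fun t ht => by simp [ht]]
  simp

/-- The action of a monomial in the twisted left regular representation. -/
noncomputable def translation (a : Fin n → ℤ) : Module.End k ((Fin n → ℤ) →₀ k) :=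
  Finsupp.linearCombination k fun b => bicharacter L a b • Finsupp.single (a + b) (1 : k)

theorem translation_single (a b : Fin n → ℤ) :
    translation L a (Finsupp.single b 1) = bicharacter L a b • Finsupp.single (a + b) (1 : k) := by
  simp [translation]

theorem translation_zero : translation L 0 = 1 := by
  refine Finsupp.lhom_ext' fun b => LinearMap.ext_ring ?_
  simp [translation_single]

theorem translation_mul (a b : Fin n → ℤ) :
    translation L a * translation L b = bicharacter L a b • translation L (a + b) := by
  refine Finsupp.lhom_ext' fun c => LinearMap.ext_ring ?_
  simp only [LinearMap.comp_apply, Finsupp.lsingle_apply, Module.End.mul_apply,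
    translation_single, LinearMap.smul_apply]
  rw [Units.smul_def (bicharacter L b c), map_smul, ← Units.smul_def, translation_single,
    smul_smul, smul_smul, bicharacter_add_left, bicharacter_add_right, add_assoc]
  congr 1
  rw [mul_comm, mul_assoc]

theorem isProjective_translation : IsProjective k (translation L) :=
  ⟨⟨1, by rw [translation_zero, one_smul]⟩, fun a b => ⟨_, translation_mul L a b⟩⟩

end TwistedRegularRepresentation

section Basis

variable {k : Type u} [Field k] {n : ℕ}

/-- The quantum torus has a basis of monomials, multiplied through the bicharacter. -/
theorem exists_basis {L : Fin n → Fin n → kˣ} (h1 : ∀ i, L i i = 1)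
    (h2 : ∀ i j, L i j * L j i = 1) (Λ : Matrix (Fin n) (Fin n) k) (hL : ∀ i j, Λ i j = L i j) :
    ∃ b : Basis (Fin n → ℤ) k (QuantumTorus k Λ), b 0 = 1 ∧
      (∀ i, b (Pi.single i 1) = y k Λ i) ∧
      ∀ a c, b a * b c = bicharacter L a c • b (a + c) := by
  have hX := isProjective_translation L
  obtain ⟨Φ, hΦ⟩ := exists_lift (Λ := Λ) (fun i => (hX.isUnit (Pi.single i 1)).unit) (by
    intro i j
    simp only [IsUnit.unit_spec, translation_mul, hL, ← Units.smul_def, smul_smul]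
    rw [bicharacter_swap h1 h2 (Pi.single i 1), prod_single, add_comm])
  simp only [IsUnit.unit_spec] at hΦ
  obtain ⟨p, hp, hpy⟩ := exists_monomials L Λ hL
  have key := (hp.comp Φ (AddMonoidHom.id _)).exists_smul_eq hX fun i => by
    obtain ⟨c, hc⟩ := hpy i
    exact ⟨c, by simp [hc, Units.smul_def, hΦ]⟩
  simp only [AddMonoidHom.id_apply] at key
  choose c hc using key
  let q : (Fin n → ℤ) → QuantumTorus k Λ := fun a => (c a)⁻¹ • p a
  have hq : ∀ a, Φ (q a) = translation L a := fun a => by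
    simp only [q, Units.smul_def, map_smul]
    rw [hc, ← Units.smul_def, inv_smul_smul]
  let ev : QuantumTorus k Λ →ₗ[k] ((Fin n → ℤ) →₀ k) :=
    (LinearMap.applyₗ (Finsupp.single 0 1)) ∘ₗ Φ.toLinearMap
  have hev : ∀ a, ev (q a) = Finsupp.single a 1 := fun a => by
    simp [ev, hq, translation_single]
  have hli : LinearIndependent k q := by
    refine LinearIndependent.of_comp ev ?_
    have : ev ∘ q = Finsupp.basisSingleOne := by
      ext1 a
      simp [hev]
    rw [this]
    exact Basis.linearIndependent _
  have hspan : Submodule.span k (Set.range q) = ⊤ :=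
    Basis.units_smul_span_eq_top (w := fun a => (c a)⁻¹) (span_range_eq_top hp hpy)
  let b := Basis.mk hli hspan.ge
  have hb : ∀ a, b a = q a := fun a => Basis.mk_apply hli hspan.ge a
  have hinj : Function.Injective Φ := by
    have : Function.Injective ev := by
      have h : ev = (b.equiv Finsupp.basisSingleOne (Equiv.refl _)).toLinearMap :=
        b.ext fun a => by
          rw [LinearEquiv.coe_coe, Basis.equiv_apply, hb, hev]
          simp
      rw [h]
      exact LinearEquiv.injective _
    exact Function.Injective.of_comp (f := fun f : Module.End k _ => f (Finsupp.single 0 1)) this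
  refine ⟨b, ?_, fun i => ?_, fun a d => ?_⟩ <;> apply hinj
  · rw [hb, hq, translation_zero, map_one]
  · rw [hb, hq, hΦ]
  · rw [map_mul, Units.smul_def, map_smul, hb, hb, hb, hq, hq, hq, translation_mul,
      Units.smul_def]

end Basis

section Units

variable {k G R : Type*} [Field k] [AddCommGroup G] [Ring R] [Algebra k R]

theorem repr_mul_of_uniqueAdd (b : Basis G k R) {β : G → G → kˣ}
    (hb : ∀ a c, b a * b c = β a c • b (a + c)) (x z : R) {s t : G}
    (h : UniqueAdd (b.repr x).support (b.repr z).support s t) :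
    b.repr (x * z) (s + t) = b.repr x s * b.repr z t * β s t := by
  classical
  have hxz : x * z = ∑ a ∈ (b.repr x).support, ∑ c ∈ (b.repr z).support,
      (b.repr x a * b.repr z c * β a c) • b (a + c) := by
    conv_lhs => rw [← b.linearCombination_repr x, ← b.linearCombination_repr z]
    rw [Finsupp.linearCombination_apply, Finsupp.linearCombination_apply, Finsupp.sum,
      Finsupp.sum, Finset.sum_mul_sum]
    refine Finset.sum_congr rfl fun a _ => Finset.sum_congr rfl fun c _ => ?_
    rw [smul_mul_smul_comm, hb, Units.smul_def, smul_smul]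
  rw [hxz]
  simp only [map_sum, map_smul, Basis.repr_self, Finsupp.coe_finsetSum, Finset.sum_apply,
    Finsupp.smul_apply, smul_eq_mul]
  rw [Finset.sum_eq_single s, Finset.sum_eq_single t]
  · simp
  · intro c _ hc
    rw [Finsupp.single_eq_of_ne, mul_zero]
    simpa using hc.symm
  · intro ht
    simp [Finsupp.notMem_support_iff.1 ht]
  · intro a ha has
    refine Finset.sum_eq_zero fun c hc => ?_
    rw [Finsupp.single_eq_of_ne, mul_zero]
    exact fun hac => has (h ha hc hac.symm).1
  · intro hs
    simp [Finsupp.notMem_support_iff.1 hs]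

/-- The units of a twisted group algebra of a group with two unique sums are the nonzero scalar
multiples of monomials. -/
theorem exists_eq_smul_of_isUnit [TwoUniqueSums G] (b : Basis G k R) {β : G → G → kˣ}
    (h0 : b 0 = 1) (hb : ∀ a c, b a * b c = β a c • b (a + c)) {u : R} (hu : IsUnit u) :
    ∃ (c : kˣ) (a : G), u = c • b a := by
  classical
  obtain ⟨v, huv⟩ := hu.exists_right_inv
  have : Nontrivial R := ⟨b 0, 0, b.ne_zero 0⟩
  have hu0 : u ≠ 0 := hu.ne_zero
  have hv0 : v ≠ 0 := by
    rintro rfl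
    simp at huv
  have hA : (b.repr u).support.Nonempty := by simpa using hu0
  have hB : (b.repr v).support.Nonempty := by simpa using hv0
  have huniq : ∀ {s t}, s ∈ (b.repr u).support → t ∈ (b.repr v).support →
      UniqueAdd (b.repr u).support (b.repr v).support s t → s + t = 0 := by
    intro s t hs ht h
    by_contra hne
    have h' := repr_mul_of_uniqueAdd b hb u v h
    rw [huv, ← h0, Basis.repr_self, Finsupp.single_eq_of_ne hne, eq_comm] at h'
    exact mul_ne_zero (mul_ne_zero (Finsupp.mem_support_iff.1 hs) (Finsupp.mem_support_iff.1 ht))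
      (β s t).ne_zero h'
  have hcard : (b.repr u).support.card * (b.repr v).support.card ≤ 1 := by
    by_contra! hlt
    obtain ⟨p, hp, q, hq, hpq, hpu, hqu⟩ := TwoUniqueSums.uniqueAdd_of_one_lt_card hlt
    rw [Finset.mem_product] at hp hq
    have := hpu hq.1 hq.2 ((huniq hq.1 hq.2 hqu).trans (huniq hp.1 hp.2 hpu).symm)
    exact hpq (Prod.ext this.1 this.2).symm
  have hcardA : (b.repr u).support.card = 1 := by
    have h1 := hA.card_pos
    have h2 := hB.card_pos
    nlinarith
  obtain ⟨a, ha⟩ := Finset.card_eq_one.1 hcardA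
  have ha0 : b.repr u a ≠ 0 := Finsupp.mem_support_iff.1 (by simp [ha])
  refine ⟨Units.mk0 _ ha0, a, ?_⟩
  refine (b.linearCombination_repr u).symm.trans ?_
  simp [Finsupp.linearCombination_apply, Finsupp.sum, ha, Units.smul_def]

theorem isProjective_basis (b : Basis G k R) {β : G → G → kˣ}
    (h0 : b 0 = 1) (hb : ∀ a c, b a * b c = β a c • b (a + c)) : IsProjective k b :=
  ⟨⟨1, by rw [h0, one_smul]⟩, fun a c => ⟨_, hb a c⟩⟩

theorem basis_smul_injective {ι : Type*} (b : Basis ι k R) {c d : kˣ} {s t : ι}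
    (h : c • b s = d • b t) : s = t ∧ c = d := by
  have h' := congrArg b.repr h
  simp only [Units.smul_def, map_smul, Basis.repr_self, Finsupp.smul_single, smul_eq_mul,
    mul_one] at h'
  rw [Finsupp.single_eq_single_iff] at h'
  simpa [Units.ext_iff] using h'

/-- A homomorphism of twisted group algebras maps monomials to scalar multiples of monomials,
through an additive map of the exponents. -/
theorem exists_addMonoidHom {G' R' : Type*} [AddCommGroup G'] [TwoUniqueSums G'] [Ring R']
    [Algebra k R'] (b : Basis G k R) {β : G → G → kˣ} (h0 : b 0 = 1)
    (hb : ∀ a c, b a * b c = β a c • b (a + c)) (b' : Basis G' k R') {β' : G' → G' → kˣ}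
    (h0' : b' 0 = 1) (hb' : ∀ a c, b' a * b' c = β' a c • b' (a + c)) (f : R →ₐ[k] R') :
    ∃ h : G →+ G', ∀ a, ∃ c : kˣ, f (b a) = c • b' (h a) := by
  choose c h hc using fun a => exists_eq_smul_of_isUnit b' h0' hb'
    (((isProjective_basis b h0 hb).isUnit a).map f)
  refine ⟨AddMonoidHom.mk' h fun s t => ?_, fun a => ⟨c a, hc a⟩⟩
  have := congrArg f (hb s t)
  rw [Units.smul_def, map_smul, map_mul, hc, hc, hc, smul_mul_smul_comm, hb',
    ← Units.smul_def, smul_smul, smul_smul] at this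
  exact (basis_smul_injective b' this).1.symm

end Units

end QuantumTorus

/-- Two quantum tori `O_Λ((k*)^n)` and `O_{Λ'}((k*)^n)` are `k`-isomorphic
iff there is `H ∈ GL_n(ℤ)` with `λ_{i,j} = ∏_{K,t} (λ'_{K,t})^{h_{K,i}·h_{t,j}}`. -/
theorem stmt7 {k : Type u} [Field k] [CharZero k] {n : ℕ} (hn : 1 ≤ n)
    (Λ Λ' : Matrix (Fin n) (Fin n) k) (hΛ : Λ.MulAntisymmetric) (hΛ' : Λ'.MulAntisymmetric) :
    Nonempty (QuantumTorus k Λ ≃ₐ[k] QuantumTorus k Λ') ↔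
      ∃ H : Matrix (Fin n) (Fin n) ℤ, IsUnit H ∧
        ∀ i j : Fin n, Λ i j = ∏ K : Fin n, ∏ t : Fin n, Λ' K t ^ (H K i * H t j) := by
  obtain ⟨L, hL⟩ : ∃ L : Fin n → Fin n → kˣ, ∀ i j, Λ i j = L i j :=
    ⟨fun i j => Units.mkOfMulEqOne _ _ (hΛ.2 i j), fun i j => rfl⟩
  obtain ⟨L', hL'⟩ : ∃ L' : Fin n → Fin n → kˣ, ∀ i j, Λ' i j = L' i j :=
    ⟨fun i j => Units.mkOfMulEqOne _ _ (hΛ'.2 i j), fun i j => rfl⟩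
  have h1 : ∀ i, L i i = 1 := fun i => Units.ext ((hL i i).symm.trans (hΛ.1 i))
  have h2 : ∀ i j, L i j * L j i = 1 := fun i j => Units.ext (by simp [← hL, hΛ.2])
  have h1' : ∀ i, L' i i = 1 := fun i => Units.ext ((hL' i i).symm.trans (hΛ'.1 i))
  have h2' : ∀ i j, L' i j * L' j i = 1 := fun i j => Units.ext (by simp [← hL', hΛ'.2])
  obtain ⟨b, hb0, hby, hb⟩ := QuantumTorus.exists_basis h1 h2 Λ hL
  obtain ⟨b', hb0', hby', hb'⟩ := QuantumTorus.exists_basis h1' h2' Λ' hL'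
  have hprod : ∀ (H : Matrix (Fin n) (Fin n) ℤ) (i j : Fin n),
      (Λ i j = ∏ K : Fin n, ∏ t : Fin n, Λ' K t ^ (H K i * H t j)) ↔
        QuantumTorus.bicharacter L' (H.col i) (H.col j) =
          L i j * QuantumTorus.bicharacter L' (H.col j) (H.col i) := by
    intro H i j
    rw [QuantumTorus.bicharacter_swap h1' h2', mul_left_inj, eq_comm, Units.ext_iff]
    simp [hL, hL', Matrix.col]
  constructor
  · rintro ⟨φ⟩
    obtain ⟨h, hh⟩ := QuantumTorus.exists_addMonoidHom b hb0 hb b' hb0' hb' φ.toAlgHom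
    obtain ⟨g, hg⟩ := QuantumTorus.exists_addMonoidHom b' hb0' hb' b hb0 hb φ.symm.toAlgHom
    have hhg : ∀ a, h (g a) = a := by
      intro a
      obtain ⟨c, hc : φ.symm (b' a) = c • b (g a)⟩ := hg a
      obtain ⟨d, hd : φ (b (g a)) = d • b' (h (g a))⟩ := hh (g a)
      have := congrArg φ hc
      rw [AlgEquiv.apply_symm_apply, Units.smul_def, map_smul, hd, ← Units.smul_def, smul_smul, ← one_smul kˣ (b' a)] at this
      exact (QuantumTorus.basis_smul_injective b' this).1.symm
    refine ⟨LinearMap.toMatrix' h.toIntLinearMap, ?_, fun i j => ?_⟩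
    · refine IsUnit.of_mul_eq_one (LinearMap.toMatrix' g.toIntLinearMap) ?_
      rw [← LinearMap.toMatrix'_mul, ← LinearMap.toMatrix'_one]
      congr 1
      exact LinearMap.ext hhg
    · rw [hprod]
      have hcol : ∀ i, (LinearMap.toMatrix' h.toIntLinearMap).col i = h (Pi.single i 1) := by
        intro i
        ext K
        simp [Matrix.col, LinearMap.toMatrix'_apply]
      rw [hcol, hcol]
      obtain ⟨c, hc⟩ := hh (Pi.single i 1)
      obtain ⟨d, hd⟩ := hh (Pi.single j 1)
      have := congrArg φ.toAlgHom (QuantumTorus.y_mul_y Λ i j)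
      rw [map_smul, map_mul, map_mul, ← hby, ← hby, hc, hd, smul_mul_smul_comm,
        smul_mul_smul_comm, hb', hb', hL, ← Units.smul_def, smul_smul, smul_smul,
        smul_smul] at this
      have := (QuantumTorus.basis_smul_injective b' this).2
      refine mul_left_cancel (a := c * d) (this.trans ?_)
      rw [mul_comm d c, mul_comm (L i j), mul_assoc]
  · rintro ⟨H, hH, hHΛ⟩
    have hp' := QuantumTorus.isProjective_basis b' hb0' hb'
    obtain ⟨φ, hφ⟩ := QuantumTorus.exists_lift (Λ := Λ) (fun i => (hp'.isUnit (H.col i)).unit) (by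
      intro i j
      simp only [IsUnit.unit_spec, hb']
      rw [(hprod H i j).1 (hHΛ i j), hL, ← Units.smul_def, smul_smul, add_comm])
    simp only [IsUnit.unit_spec] at hφ
    have key := ((QuantumTorus.isProjective_basis b hb0 hb).comp φ
      (AddMonoidHom.id _)).exists_smul_eq
        (hp'.comp (AlgHom.id k _) H.mulVecLin.toAddMonoidHom) fun i => ⟨1, by
          simp [hby, hφ]⟩
    choose c hc using key
    let e : (Fin n → ℤ) ≃ (Fin n → ℤ) := (Matrix.toLinearEquiv' H hH.invertible).toEquiv
    have he : φ.toLinearMap =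
        (b.equiv ((b'.reindex e.symm).unitsSMul c) (Equiv.refl _)).toLinearMap :=
      b.ext fun a => by
        rw [LinearEquiv.coe_coe, Module.Basis.equiv_apply, Equiv.refl_apply,
          Module.Basis.unitsSMul_apply, Module.Basis.reindex_apply, Equiv.symm_symm]
        exact hc a
    refine ⟨AlgEquiv.ofBijective φ ?_⟩
    change Function.Bijective φ.toLinearMap
    rw [he]
    exact LinearEquiv.bijective _
end

section
/- Let n ≥ 1 and let Λ ∈ M_n(k*) be multiplicatively antisymmetric. If the quantum torus O_Λ((k*)^n) is a simple ring, then every k-algebra endomorphism of O_Λ((k*)^n) is bijective, i.e. is a k-algebra automorphism. -/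
universe u

/-- An endomorphism of a finite free module over a domain which preserves a bilinear map with
trivial left radical is surjective. -/
theorem LinearMap.surjective_of_preserves_separatingLeft {R ι M : Type*} [CommRing R] [IsDomain R]
    [Fintype ι] [AddCommGroup M] [Module R M] (B : (ι → R) →ₗ[R] (ι → R) →ₗ[R] M)
    (hB : ∀ x, (∀ y, B x y = 0) → x = 0) (A : (ι → R) →ₗ[R] (ι → R))
    (hA : ∀ x y, B (A x) (A y) = B x y) : Function.Surjective A := by
  classical
  have hinj : Function.Injective A := by
    refine (injective_iff_map_eq_zero A).2 fun x hx => hB x fun y => ?_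
    rw [← hA, hx, map_zero, LinearMap.zero_apply]
  have hpow : ∀ (m : ℕ) x y, B ((A ^ m) x) ((A ^ m) y) = B x y := by
    intro m
    induction m with
    | zero => simp
    | succ m ih => intro x y; rw [pow_succ', Module.End.mul_apply, Module.End.mul_apply, hA, ih]
  have hpowinj : ∀ m : ℕ, Function.Injective ⇑(A ^ m) := fun m => by
    rw [Module.End.coe_pow]; exact hinj.iterate m
  have hrange : ∀ (m : ℕ) z, (∀ y, B z ((A ^ m) y) = 0) → z = 0 := by
    intro m z hz
    have hd : LinearMap.det (A ^ m) ≠ 0 := by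
      rw [Ne, LinearMap.det_eq_zero_iff_ker_ne_bot, not_not]
      exact LinearMap.ker_eq_bot.2 (hpowinj m)
    have key : ∀ y, LinearMap.det (A ^ m) • y =
        (A ^ m) (((LinearMap.toMatrix' (A ^ m)).adjugate).mulVec y) := by
      intro y
      rw [← LinearMap.toMatrix'_mulVec (A ^ m), Matrix.mulVec_mulVec, Matrix.mul_adjugate,
        LinearMap.det_toMatrix', Matrix.smul_mulVec, Matrix.one_mulVec]
    refine (smul_eq_zero_iff_right hd).1 (hB _ fun y => ?_)
    rw [map_smul, LinearMap.smul_apply, ← map_smul, key, hz]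
  set p := A.charpoly
  set d := p.natDegree
  have hrev : ∀ x, ∑ i ∈ Finset.range (d + 1), p.coeff i • (A ^ (d - i)) x = 0 := by
    refine fun x => hrange d _ fun y => ?_
    have hy : ∑ i ∈ Finset.range (d + 1), p.coeff i • (A ^ i) y = 0 := by
      have h := congrArg (fun g => g y) A.aeval_self_charpoly
      rw [Polynomial.aeval_eq_sum_range] at h
      simpa using h
    calc B (∑ i ∈ Finset.range (d + 1), p.coeff i • (A ^ (d - i)) x) ((A ^ d) y)
        = ∑ i ∈ Finset.range (d + 1), p.coeff i • B x ((A ^ i) y) := by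
          rw [map_sum, LinearMap.sum_apply]
          refine Finset.sum_congr rfl fun i hi => ?_
          have hid : d = (d - i) + i := by have := Finset.mem_range.1 hi; omega
          have hsplit : (A ^ d) y = (A ^ (d - i)) ((A ^ i) y) := by
            rw [← Module.End.mul_apply, ← pow_add, ← hid]
          rw [map_smul, LinearMap.smul_apply, hsplit, hpow]
      _ = B x (∑ i ∈ Finset.range (d + 1), p.coeff i • (A ^ i) y) := by simp
      _ = 0 := by rw [hy, map_zero]
  intro x
  have hx := hrev x
  rw [Finset.sum_range_succ, A.charpoly_monic.coeff_natDegree, Nat.sub_self, pow_zero,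
    one_smul, Module.End.one_apply] at hx
  refine ⟨-∑ i ∈ Finset.range d, p.coeff i • (A ^ (d - i - 1)) x, ?_⟩
  rw [map_neg, neg_eq_iff_add_eq_zero, map_sum, ← hx]
  congr 1
  refine Finset.sum_congr rfl fun i hi => ?_
  have hid : d - i = (d - i - 1) + 1 := by have := Finset.mem_range.1 hi; omega
  conv_rhs => rw [hid]
  rw [map_smul, pow_succ', Module.End.mul_apply]

namespace TwistedGroupAlgebra

variable {k G : Type*} [Field k] [AddCommGroup G] (s : G →ₗ[ℤ] G →ₗ[ℤ] Additive kˣ)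

/-- The `k`-valued bicharacter attached to `s`. -/
def bichar (a b : G) : k := ((s a b).toMul : kˣ)

theorem bichar_ne_zero (a b : G) : bichar s a b ≠ 0 := Units.ne_zero _

theorem bichar_add_left (a b c : G) : bichar s (a + b) c = bichar s a c * bichar s b c := by
  simp [bichar]

theorem bichar_add_right (a b c : G) : bichar s a (b + c) = bichar s a b * bichar s a c := by
  simp [bichar]

@[simp] theorem bichar_zero_left (a : G) : bichar s 0 a = 1 := by simp [bichar]

@[simp] theorem bichar_zero_right (a : G) : bichar s a 0 = 1 := by simp [bichar]

theorem bichar_neg_right (a b : G) : bichar s a (-b) = (bichar s a b)⁻¹ := by simp [bichar]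

theorem bichar_neg_left (a b : G) : bichar s (-a) b = (bichar s a b)⁻¹ := by simp [bichar]

/-- Left multiplication by the monomial of degree `a` in the group algebra of `G` twisted by
`bichar s`. -/
noncomputable def mulLeft (a : G) : Module.End k (G →₀ k) :=
  Finsupp.linearCombination k fun b => Finsupp.single (a + b) (bichar s a b)

theorem mulLeft_single (a b : G) (c : k) :
    mulLeft s a (Finsupp.single b c) = Finsupp.single (a + b) (c * bichar s a b) := by
  simp [mulLeft]

theorem mulLeft_mul (a b : G) : mulLeft s a * mulLeft s b = bichar s a b • mulLeft s (a + b) := by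
  ext x : 2
  simp only [LinearMap.comp_apply, Finsupp.lsingle_apply, Module.End.mul_apply, mulLeft_single,
    LinearMap.smul_apply, Finsupp.smul_single, bichar_add_left, bichar_add_right, add_assoc,
    smul_eq_mul]
  congr 1
  ring

@[simp] theorem mulLeft_zero : mulLeft s 0 = 1 := by
  ext x : 2
  simp [mulLeft_single]

theorem mulLeft_add (a b : G) :
    mulLeft s (a + b) = (bichar s a b)⁻¹ • (mulLeft s a * mulLeft s b) := by
  rw [mulLeft_mul, inv_smul_smul₀ (bichar_ne_zero s a b)]

/-- Left multiplication by an arbitrary element of the twisted group algebra. -/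
noncomputable def mul : (G →₀ k) →ₗ[k] Module.End k (G →₀ k) :=
  Finsupp.linearCombination k (mulLeft s)

@[simp] theorem mul_single (a : G) (c : k) : mul s (Finsupp.single a c) = c • mulLeft s a := by
  simp [mul]

theorem mul_apply_one (u : G →₀ k) : mul s u (Finsupp.single 0 1) = u := by
  induction u using Finsupp.induction_linear with
  | zero => simp
  | add u v hu hv => simp [hu, hv]
  | single a c => simp [mulLeft_single]

theorem mul_mul (u v : G →₀ k) : mul s u * mul s v = mul s (mul s u v) := by
  induction u using Finsupp.induction_linear with
  | zero => simp
  | add u u' hu hv => simp [hu, hv, add_mul]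
  | single a c =>
    induction v using Finsupp.induction_linear with
    | zero => simp
    | add u u' hu hv => simp only [map_add, mul_add, hu, hv]
    | single b d =>
      simp only [mul_single, LinearMap.smul_apply, mulLeft_single, Finsupp.smul_single,
        smul_mul_smul_comm, mulLeft_mul, smul_smul, smul_eq_mul, mul_assoc]

open Classical in
theorem mul_apply_apply (u v : G →₀ k) (g : G) :
    mul s u v g = ∑ a ∈ u.support, ∑ b ∈ v.support,
      (if a + b = g then u a * v b * bichar s a b else 0) := by
  conv_lhs => rw [← Finsupp.sum_single u, ← Finsupp.sum_single v]
  simp only [Finsupp.sum, map_sum, mul_single, LinearMap.sum_apply, LinearMap.smul_apply,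
    mulLeft_single, Finsupp.smul_single, smul_eq_mul, Finsupp.finsetSum_apply,
    Finsupp.single_apply, mul_assoc]
  exact Finset.sum_comm

theorem mul_apply_add_ne_zero {u v : G →₀ k} {a b : G} (ha : a ∈ u.support) (hb : b ∈ v.support)
    (h : UniqueAdd u.support v.support a b) : mul s u v (a + b) ≠ 0 := by
  rw [mul_apply_apply, Finset.sum_eq_single_of_mem a ha, Finset.sum_eq_single_of_mem b hb]
  · rw [if_pos rfl]
    exact mul_ne_zero (mul_ne_zero (Finsupp.mem_support_iff.1 ha) (Finsupp.mem_support_iff.1 hb))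
      (bichar_ne_zero s a b)
  · exact fun b' hb' hne => if_neg fun he => hne (h ha hb' he).2
  · exact fun a' ha' hne => Finset.sum_eq_zero fun b' hb' => if_neg fun he => hne (h ha' hb' he).1

theorem exists_eq_single_of_mul_eq_one [TwoUniqueSums G] {u v : G →₀ k}
    (h : mul s u v = Finsupp.single 0 1) : ∃ (a : G) (c : k), c ≠ 0 ∧ u = Finsupp.single a c := by
  classical
  have hu : u ≠ 0 := by rintro rfl; simp [eq_comm] at h
  have hv : v ≠ 0 := by rintro rfl; simp [eq_comm] at h
  have hsupp : ∀ g, mul s u v g ≠ 0 → g = 0 := by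
    intro g hg
    rw [h, Finsupp.single_apply] at hg
    by_contra hne
    exact hg (if_neg (Ne.symm hne))
  have hcard : u.support.card * v.support.card ≤ 1 := by
    by_contra! hlt
    obtain ⟨p, hp, q, hq, hpq, hp', hq'⟩ := TwoUniqueSums.uniqueAdd_of_one_lt_card hlt
    rw [Finset.mem_product] at hp hq
    have h1 := hsupp _ (mul_apply_add_ne_zero s hp.1 hp.2 hp')
    have h2 := hsupp _ (mul_apply_add_ne_zero s hq.1 hq.2 hq')
    have h3 := hp' hq.1 hq.2 (h2.trans h1.symm)
    exact hpq (Prod.ext h3.1 h3.2).symm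
  have hv' : 0 < v.support.card := Finset.card_pos.2 (Finsupp.support_nonempty_iff.2 hv)
  have hu' : u.support.card ≤ 1 := le_trans (Nat.le_mul_of_pos_right _ hv') hcard
  obtain ⟨a, c, rfl⟩ := Finsupp.card_support_le_one'.1 hu'
  exact ⟨a, c, fun hc => hu (by simp [hc]), rfl⟩

theorem eq_of_smul_mulLeft_eq {a b : G} {c d : k} (hc : c ≠ 0)
    (h : c • mulLeft s a = d • mulLeft s b) : a = b ∧ c = d := by
  have h1 := LinearMap.congr_fun h (Finsupp.single 0 1)
  simp only [LinearMap.smul_apply, mulLeft_single, bichar_zero_right, add_zero,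
    Finsupp.smul_single, smul_eq_mul, mul_one] at h1
  rcases (Finsupp.single_eq_single_iff _ _ _ _).1 h1 with h2 | h2
  · exact h2
  · exact absurd h2.1 hc

theorem mulLeft_comm (a b : G) :
    mulLeft s a * mulLeft s b = bichar (s - s.flip) a b • (mulLeft s b * mulLeft s a) := by
  rw [mulLeft_mul, mulLeft_mul, smul_smul, add_comm b a]
  congr 1
  have : bichar (s - s.flip) a b = bichar s a b * (bichar s b a)⁻¹ := by
    simp [bichar, div_eq_mul_inv]
  rw [this, inv_mul_cancel_right₀ (bichar_ne_zero s b a)]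

theorem mulLeft_mul_neg (a : G) :
    mulLeft s a * (bichar s a a • mulLeft s (-a)) = 1 := by
  rw [mul_smul_comm, mulLeft_mul, smul_smul, bichar_neg_right,
    mul_inv_cancel₀ (bichar_ne_zero s a a), one_smul, add_neg_cancel, mulLeft_zero]

section Representation

variable {T : Type*} [Ring T] [Algebra k T] {s} {ρ : T →ₐ[k] Module.End k (G →₀ k)}

theorem exists_eq_smul_mulLeft [TwoUniqueSums G]
    (hρ : LinearMap.range ρ.toLinearMap = LinearMap.range (mul s)) {t t' : T} (h : t * t' = 1) :
    ∃ (a : G) (c : k), c ≠ 0 ∧ ρ t = c • mulLeft s a := by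
  have hmem : ∀ t, ∃ u, mul s u = ρ t := fun t => by
    have : ρ t ∈ LinearMap.range ρ.toLinearMap := ⟨t, rfl⟩
    rwa [hρ] at this
  obtain ⟨u, hu⟩ := hmem t
  obtain ⟨v, hv⟩ := hmem t'
  have huv : mul s u v = Finsupp.single 0 1 := by
    have h1 := congrArg ρ h
    rw [map_mul, map_one, ← hu, ← hv, mul_mul] at h1
    rw [← mul_apply_one s (mul s u v), h1, Module.End.one_apply]
  obtain ⟨a, c, hc, rfl⟩ := exists_eq_single_of_mul_eq_one s huv
  exact ⟨a, c, hc, by rw [← hu, mul_single]⟩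

theorem exists_eq_mulLeft (hρ : LinearMap.range ρ.toLinearMap = LinearMap.range (mul s)) (a : G) :
    ∃ t, ρ t = mulLeft s a := by
  have : mulLeft s a ∈ LinearMap.range (mul s) := ⟨Finsupp.single a 1, by simp⟩
  rwa [← hρ] at this

/-- If an algebra spanned by the twisted monomials is simple, then the commutation form on degrees
has trivial radical. -/
theorem eq_zero_of_commutator_eq_zero [TwoUniqueSums G] [IsSimpleRing T]
    (hρ : LinearMap.range ρ.toLinearMap = LinearMap.range (mul s)) {a : G}
    (ha : ∀ b, (s - s.flip) a b = 0) : a = 0 := by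
  have hinj : Function.Injective ρ := ρ.toRingHom.injective
  obtain ⟨y, hy⟩ := exists_eq_mulLeft hρ a
  have hcomm : ∀ b, Commute (mulLeft s a) (mulLeft s b) := fun b => by
    rw [Commute, SemiconjBy, mulLeft_comm, bichar, ha, toMul_zero, Units.val_one, one_smul]
  have hcentral : ∀ t, Commute y t := by
    intro t
    apply hinj
    have : ρ t ∈ LinearMap.range ρ.toLinearMap := ⟨t, rfl⟩
    rw [hρ] at this
    obtain ⟨u, hu⟩ := this
    rw [map_mul, map_mul, hy, ← hu]
    clear hu
    induction u using Finsupp.induction_linear with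
    | zero => simp
    | add u v hu hv => rw [map_add, mul_add, add_mul, hu, hv]
    | single b c => rw [mul_single]; exact (hcomm b).smul_right c
  by_contra hne
  have hy1 : y - 1 ≠ 0 := by
    intro h
    have h1 := congrArg ρ (sub_eq_zero.1 h)
    rw [hy, map_one, ← mulLeft_zero s] at h1
    exact hne (eq_of_smul_mulLeft_eq s (one_ne_zero (α := k)) (congrArg _ h1)).1
  have hmem : y - 1 ∈ Subring.center T :=
    Subring.mem_center_iff.2 fun t => (((hcentral t).sub_left (Commute.one_left t)).eq).symm
  obtain ⟨z, hz⟩ := (IsSimpleRing.isField_center T).mul_inv_cancel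
    (a := ⟨y - 1, hmem⟩) (fun h => hy1 (congrArg Subtype.val h))
  obtain ⟨b, c, -, hb⟩ := exists_eq_smul_mulLeft hρ (congrArg Subtype.val hz)
  have h1 := LinearMap.congr_fun hb (Finsupp.single 0 1)
  have h2 := DFunLike.congr_fun h1 0
  have h3 := DFunLike.congr_fun h1 a
  simp only [map_sub, map_one, hy, LinearMap.sub_apply, LinearMap.smul_apply, mulLeft_single,
    Module.End.one_apply, Finsupp.smul_single, Finsupp.sub_apply, add_zero, bichar_zero_right,
    smul_eq_mul, mul_one, Finsupp.single_eq_same, Finsupp.single_eq_of_ne hne,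
    Finsupp.single_eq_of_ne (Ne.symm hne), zero_sub, sub_zero] at h2 h3
  rcases eq_or_ne 0 b with rfl | hb0
  · rw [Finsupp.single_eq_of_ne hne] at h3
    exact one_ne_zero h3
  · rw [Finsupp.single_eq_of_ne hb0] at h2
    exact neg_ne_zero.2 one_ne_zero h2

end Representation

/-- Every endomorphism of a simple algebra which is spanned by the twisted monomials indexed by a
finite rank lattice is bijective. -/
theorem bijective_of_isSimpleRing {ι T : Type*} [Fintype ι] [Ring T] [Algebra k T] [IsSimpleRing T]
    {s : (ι → ℤ) →ₗ[ℤ] (ι → ℤ) →ₗ[ℤ] Additive kˣ} {ρ : T →ₐ[k] Module.End k ((ι → ℤ) →₀ k)}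
    (hρ : LinearMap.range ρ.toLinearMap = LinearMap.range (mul s)) (f : T →ₐ[k] T) :
    Function.Bijective f := by
  have hinj : Function.Injective ρ := ρ.toRingHom.injective
  choose y hy using exists_eq_mulLeft hρ
  have hmon : ∀ a, ∃ (b : ι → ℤ) (c : k), c ≠ 0 ∧ ρ (f (y a)) = c • mulLeft s b := by
    intro a
    refine exists_eq_smul_mulLeft hρ (t' := f (bichar s a a • y (-a))) ?_
    rw [← map_mul]
    convert map_one f
    apply hinj
    rw [map_mul, map_smul, map_one, hy, hy, mulLeft_mul_neg]
  choose A c hc hA using hmon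
  have hadd : ∀ a b, A (a + b) = A a + A b := by
    intro a b
    have hab : y (a + b) = (bichar s a b)⁻¹ • (y a * y b) := by
      apply hinj
      rw [map_smul, map_mul, hy, hy, hy, mulLeft_add]
    refine (eq_of_smul_mulLeft_eq s (hc (a + b)) (d := (bichar s a b)⁻¹ *
      (c a * c b * bichar s (A a) (A b))) ?_).1
    rw [← hA, hab, map_smul, map_smul, map_mul, map_mul, hA, hA, smul_mul_smul_comm, mulLeft_mul,
      smul_smul, smul_smul, mul_assoc]
  have hform : ∀ a b, (s - s.flip) (A a) (A b) = (s - s.flip) a b := by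
    intro a b
    have hab : y a * y b = bichar (s - s.flip) a b • (y b * y a) := by
      apply hinj
      rw [map_smul, map_mul, map_mul, hy, hy, mulLeft_comm]
    have h := congrArg (fun t => ρ (f t)) hab
    simp only [map_smul, map_mul, hA, smul_mul_smul_comm] at h
    rw [mulLeft_comm, mul_comm (c b), mulLeft_mul] at h
    simp only [smul_smul, ← mul_assoc] at h
    have hne : bichar s (A b) (A a) ≠ 0 := bichar_ne_zero s _ _
    have heq := (eq_of_smul_mulLeft_eq s (mul_ne_zero (mul_ne_zero (mul_ne_zero (hc a) (hc b))
      (bichar_ne_zero _ _ _)) hne) h).2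
    have hval : bichar (s - s.flip) (A a) (A b) = bichar (s - s.flip) a b := by
      refine mul_left_cancel₀ (mul_ne_zero (hc a) (hc b)) (mul_right_cancel₀ hne ?_)
      rw [heq]
      ring
    exact Additive.toMul.injective (Units.ext hval)
  have hsurj : Function.Surjective A :=
    LinearMap.surjective_of_preserves_separatingLeft (s - s.flip)
      (fun _ => eq_zero_of_commutator_eq_zero hρ) (AddMonoidHom.mk' A hadd).toIntLinearMap hform
  refine ⟨f.toRingHom.injective, fun t => ?_⟩
  have ht : ρ t ∈ LinearMap.range (mul s) := hρ ▸ ⟨t, rfl⟩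
  have hle : LinearMap.range (mul s) ≤ LinearMap.range (ρ.comp f).toLinearMap := by
    rw [mul, Finsupp.range_linearCombination, Submodule.span_le]
    rintro _ ⟨b, rfl⟩
    obtain ⟨a, rfl⟩ := hsurj b
    refine ⟨(c a)⁻¹ • y a, ?_⟩
    rw [map_smul]
    change (c a)⁻¹ • ρ (f (y a)) = _
    rw [hA, inv_smul_smul₀ (hc a)]
  obtain ⟨t', ht'⟩ := hle ht
  exact ⟨t', hinj ht'⟩

end TwistedGroupAlgebra

namespace QuantumTorus

open TwistedGroupAlgebra

variable {k : Type*} [Field k] {n : ℕ} {Λ : Matrix (Fin n) (Fin n) k}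

/-- The bilinear map on degrees whose bichar is the cocycle of the quantum torus for the ordered
monomials. -/
noncomputable def cocycle (hΛ : Λ.MulAntisymmetric) :
    (Fin n → ℤ) →ₗ[ℤ] (Fin n → ℤ) →ₗ[ℤ] Additive kˣ :=
  LinearMap.mk₂ ℤ (fun a b => ∑ i, ∑ j, (a i * b j) •
      if j < i then Additive.ofMul (Units.mk (Λ i j) (Λ j i) (hΛ.2 i j) (hΛ.2 j i)) else 0)
    (fun _ _ _ => by simp only [Pi.add_apply, add_mul, add_zsmul, Finset.sum_add_distrib])
    (fun _ _ _ => by simp only [Pi.smul_apply, smul_eq_mul, mul_assoc, mul_smul, Finset.smul_sum])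
    (fun _ _ _ => by simp only [Pi.add_apply, mul_add, add_zsmul, Finset.sum_add_distrib])
    (fun _ _ _ => by
      simp only [Pi.smul_apply, smul_eq_mul, mul_left_comm, mul_smul, Finset.smul_sum])

theorem bichar_cocycle_single (hΛ : Λ.MulAntisymmetric) (i j : Fin n) :
    bichar (cocycle hΛ) (Pi.single i 1) (Pi.single j 1) = if j < i then Λ i j else 1 := by
  have h : cocycle hΛ (Pi.single i 1) (Pi.single j 1) =
      if j < i then Additive.ofMul (Units.mk (Λ i j) (Λ j i) (hΛ.2 i j) (hΛ.2 j i)) else 0 := by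
    rw [cocycle, LinearMap.mk₂_apply, Finset.sum_eq_single_of_mem i (Finset.mem_univ i),
      Finset.sum_eq_single_of_mem j (Finset.mem_univ j)]
    · simp
    · exact fun j' _ hne => by rw [Pi.single_eq_of_ne hne, mul_zero, zero_smul]
    · exact fun i' _ hne => Finset.sum_eq_zero fun j' _ => by
        rw [Pi.single_eq_of_ne hne, zero_mul, zero_smul]
  rw [bichar, h]
  split_ifs <;> rfl

/-- The images of the generators of the quantum torus under the left regular representation. -/
noncomputable def generatorImage (hΛ : Λ.MulAntisymmetric) :
    Fin n ⊕ Fin n → Module.End k ((Fin n → ℤ) →₀ k) :=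
  Sum.elim (fun i => mulLeft (cocycle hΛ) (Pi.single i 1))
    fun i => mulLeft (cocycle hΛ) (-Pi.single i 1)

theorem lift_generatorImage_rel (hΛ : Λ.MulAntisymmetric)
    ⦃x y : FreeAlgebra k (Fin n ⊕ Fin n)⦄ (h : QTorusRel k Λ x y) :
    FreeAlgebra.lift k (generatorImage hΛ) x = FreeAlgebra.lift k (generatorImage hΛ) y := by
  have hself : ∀ i, bichar (cocycle hΛ) (Pi.single i 1) (Pi.single i 1) = 1 := fun i => by
    rw [bichar_cocycle_single, if_neg (lt_irrefl i)]
  cases h with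
  | comm i j =>
    simp only [map_mul, map_smul, FreeAlgebra.lift_ι_apply, generatorImage, Sum.elim_inl,
      mulLeft_mul, bichar_cocycle_single, ← Algebra.smul_def, smul_smul]
    rw [add_comm]
    congr 1
    rcases lt_trichotomy i j with hij | rfl | hij
    · rw [if_neg hij.not_gt, if_pos hij, hΛ.2]
    · simp [hΛ.1]
    · rw [if_pos hij, if_neg hij.not_gt, mul_one]
  | mul_inv i =>
    simp only [map_mul, map_one, FreeAlgebra.lift_ι_apply, generatorImage, Sum.elim_inl,
      Sum.elim_inr, mulLeft_mul, bichar_neg_right, hself, inv_one, one_smul, add_neg_cancel,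
      mulLeft_zero]
  | inv_mul i =>
    simp only [map_mul, map_one, FreeAlgebra.lift_ι_apply, generatorImage, Sum.elim_inl,
      Sum.elim_inr, mulLeft_mul, bichar_neg_left, hself, inv_one, one_smul, neg_add_cancel,
      mulLeft_zero]

/-- The left regular representation of the quantum torus. -/
noncomputable def regular (hΛ : Λ.MulAntisymmetric) :
    QuantumTorus k Λ →ₐ[k] Module.End k ((Fin n → ℤ) →₀ k) :=
  RingQuot.liftAlgHom k ⟨FreeAlgebra.lift k (generatorImage hΛ), lift_generatorImage_rel hΛ⟩

theorem regular_mk (hΛ : Λ.MulAntisymmetric) (x : FreeAlgebra k (Fin n ⊕ Fin n)) :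
    regular hΛ (RingQuot.mkAlgHom k (QTorusRel k Λ) x : RingQuot (QTorusRel k Λ)) =
      FreeAlgebra.lift k (generatorImage hΛ) x :=
  RingQuot.liftAlgHom_mkAlgHom_apply ..

theorem range_regular (hΛ : Λ.MulAntisymmetric) :
    LinearMap.range (regular hΛ).toLinearMap = LinearMap.range (mul (cocycle hΛ)) := by
  apply le_antisymm
  · rintro _ ⟨t, rfl⟩
    obtain ⟨x, rfl⟩ := RingQuot.mkAlgHom_surjective k (QTorusRel k Λ) t
    change regular hΛ (RingQuot.mkAlgHom k (QTorusRel k Λ) x : RingQuot (QTorusRel k Λ)) ∈ _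
    rw [regular_mk]
    induction x with
    | grade0 c => exact ⟨Finsupp.single 0 c, by simp [Algebra.algebraMap_eq_smul_one]⟩
    | grade1 x =>
      rw [FreeAlgebra.lift_ι_apply]
      rcases x with i | i
      · exact ⟨Finsupp.single (Pi.single i 1) 1, by simp [generatorImage]⟩
      · exact ⟨Finsupp.single (-Pi.single i 1) 1, by simp [generatorImage]⟩
    | mul a b ha hb =>
      obtain ⟨u, hu⟩ := ha
      obtain ⟨v, hv⟩ := hb
      exact ⟨mul _ u v, by rw [map_mul, ← hu, ← hv, mul_mul]⟩
    | add a b ha hb => rw [map_add]; exact add_mem ha hb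
  · set P := LinearMap.range (regular hΛ).toLinearMap
    have hgen : ∀ x, generatorImage hΛ x ∈ P := fun x =>
      ⟨(RingQuot.mkAlgHom k (QTorusRel k Λ) (FreeAlgebra.ι k x) : RingQuot (QTorusRel k Λ)),
        (regular_mk hΛ _).trans (FreeAlgebra.lift_ι_apply _ _)⟩
    have hPadd : ∀ {a b}, mulLeft (cocycle hΛ) a ∈ P → mulLeft (cocycle hΛ) b ∈ P →
        mulLeft (cocycle hΛ) (a + b) ∈ P := by
      rintro a b ⟨x, hx⟩ ⟨y, hy⟩
      rw [mulLeft_add]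
      exact P.smul_mem _ ⟨x * y, by rw [← hx, ← hy]; exact map_mul (regular hΛ) x y⟩
    let S : AddSubgroup (Fin n → ℤ) :=
      { carrier := {a | mulLeft (cocycle hΛ) a ∈ P ∧ mulLeft (cocycle hΛ) (-a) ∈ P}
        zero_mem' := by
          have h1 : mulLeft (cocycle hΛ) 0 ∈ P :=
            ⟨1, by rw [mulLeft_zero]; exact map_one (regular hΛ)⟩
          exact ⟨h1, by rwa [neg_zero]⟩
        add_mem' := fun ha hb => ⟨hPadd ha.1 hb.1, by rw [neg_add]; exact hPadd ha.2 hb.2⟩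
        neg_mem' := fun ha => ⟨ha.2, by rw [neg_neg]; exact ha.1⟩ }
    have hS : ∀ a, a ∈ S := fun a => by
      rw [pi_eq_sum_univ' a]
      exact S.sum_mem fun i _ => S.zsmul_mem ⟨hgen (Sum.inl i), hgen (Sum.inr i)⟩ _
    rw [mul, Finsupp.range_linearCombination, Submodule.span_le]
    rintro _ ⟨a, rfl⟩
    exact (hS a).1

end QuantumTorus

/-- Every `k`-algebra endomorphism of a simple quantum torus is an
automorphism. -/
theorem stmt8 {k : Type u} [Field k] [CharZero k] {n : ℕ} (hn : 1 ≤ n)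
    (Λ : Matrix (Fin n) (Fin n) k) (hΛ : Λ.MulAntisymmetric)
    (hsimple : IsSimpleRing (QuantumTorus k Λ)) :
    ∀ f : QuantumTorus k Λ →ₐ[k] QuantumTorus k Λ, Function.Bijective f :=
  TwistedGroupAlgebra.bijective_of_isSimpleRing (QuantumTorus.range_regular hΛ)
end
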